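/- Let A be a unital C*-algebra with the Dixmier property. The following conditions are equivalent: (i) A has the singleton Dixmier property; (ii) there exists a centre-valued trace on A; (iii) for every maximal closed two-sided ideal M of A, the quotient A/M has at least one tracial state. Moreover, when these equivalent conditions hold, the centre-valued trace R is unique, {R(a)} = D_A(a) ∩ Z(A) for every a ∈ A, and for every maximal closed two-sided ideal M of A the set of tracial states of A/M is a singleton. -/

import Mathlib

open scoped ComplexOrder

noncomputable section

variable {A : Type*} [CStarAlgebra A]

/-- A tracial state on a C*-algebra: a positive linear functional of norm 1 with the trace
property. -/
def IsTracialState (τ : A →L[ℂ] ℂ) : Prop :=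
  ‖τ‖ = 1 ∧ (∀ a : A, 0 ≤ τ (star a * a)) ∧ ∀ a b : A, τ (a * b) = τ (b * a)

/-- A closed two-sided ideal of a C*-algebra, regarded as a `ℂ`-submodule. -/
def IsClosedTwoSidedIdeal (I : Submodule ℂ A) : Prop :=
  IsClosed (I : Set A) ∧ ∀ a b : A, b ∈ I → a * b ∈ I ∧ b * a ∈ I

/-- A maximal (proper, closed, two-sided) ideal of a C*-algebra. -/
def IsMaximalClosedIdeal (M : Submodule ℂ A) : Prop :=
  IsClosedTwoSidedIdeal M ∧ M ≠ ⊤ ∧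
    ∀ J : Submodule ℂ A, IsClosedTwoSidedIdeal J → J ≠ ⊤ → M ≤ J → J = M

/-- The Dixmier set of `a`: the norm-closed convex hull of the unitary conjugates of `a`. -/
def dixmierSet (a : A) : Set A :=
  closure (convexHull ℝ {b : A | ∃ u : unitary A, b = (u : A) * a * star (u : A)})

/-- The Dixmier property. -/
def DixmierProperty (A : Type*) [CStarAlgebra A] : Prop :=
  ∀ a : A, (dixmierSet a ∩ Set.center A).Nonempty

/-- The singleton Dixmier property. -/
def SingletonDixmierProperty (A : Type*) [CStarAlgebra A] : Prop :=
  ∀ a : A, ∃ z : A, dixmierSet a ∩ Set.center A = {z}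

/-- A centre-valued trace on `A`: a positive, linear contraction `R : A → Z(A)` fixing the
centre and satisfying the trace identity. Positivity is expressed by `R` mapping elements of
the form `star a * a` to elements of that form. -/
def IsCentreValuedTrace (R : A →L[ℂ] A) : Prop :=
  (∀ a : A, R a ∈ Set.center A) ∧ ‖R‖ ≤ 1 ∧
    (∀ a : A, ∃ b : A, R (star a * a) = star b * b) ∧
    (∀ z ∈ Set.center A, R z = z) ∧ ∀ a b : A, R (a * b) = R (b * a)

section DixmierSet

/-- The averaging map `x ↦ u x u*` as an `ℝ`-linear map. -/
def unitaryConj (u : unitary A) : A →ₗ[ℝ] A := LinearMap.mulLeftRight ℝ ((u : A), star (u : A))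

@[simp]
lemma unitaryConj_apply (u : unitary A) (x : A) :
    unitaryConj u x = (u : A) * x * star (u : A) := by
  simp [unitaryConj]

lemma dixmierSet_subset {a : A} {S : Set A} (hc : IsClosed S) (hconv : Convex ℝ S)
    (h : ∀ u : unitary A, (u : A) * a * star (u : A) ∈ S) : dixmierSet a ⊆ S := by
  refine closure_minimal (convexHull_min ?_ hconv) hc
  rintro _ ⟨u, rfl⟩
  exact h u

lemma isClosed_dixmierSet (a : A) : IsClosed (dixmierSet a) := isClosed_closure

lemma convex_dixmierSet (a : A) : Convex ℝ (dixmierSet a) := (convex_convexHull ℝ _).closure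

lemma conj_mem_dixmierSet (a : A) (u : unitary A) :
    (u : A) * a * star (u : A) ∈ dixmierSet a :=
  subset_closure (subset_convexHull ℝ _ ⟨u, rfl⟩)

/-- A continuous real-linear map sends `D(a)` into `D(b)` if it sends the unitary orbit of `a`
into `D(b)`. -/
lemma map_mem_dixmierSet {a b : A} (f : A →ₗ[ℝ] A) (hf : Continuous f)
    (h : ∀ u : unitary A, f ((u : A) * a * star (u : A)) ∈ dixmierSet b) {x : A}
    (hx : x ∈ dixmierSet a) : f x ∈ dixmierSet b :=
  dixmierSet_subset (S := f ⁻¹' dixmierSet b) ((isClosed_dixmierSet b).preimage hf)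
    ((convex_dixmierSet b).linear_preimage f) h hx

lemma conj_mem_dixmierSet_of_mem {a x : A} (hx : x ∈ dixmierSet a) (v : unitary A) :
    (v : A) * x * star (v : A) ∈ dixmierSet a := by
  have hc : Continuous (unitaryConj v : A →ₗ[ℝ] A) := by
    have : ((unitaryConj v : A →ₗ[ℝ] A) : A → A) = fun x => (v : A) * x * star (v : A) := by
      ext x; simp
    rw [this]; fun_prop
  have := map_mem_dixmierSet (unitaryConj v) hc (b := a) (fun u => ?_) hx
  · simpa using this
  · simpa [mul_assoc] using conj_mem_dixmierSet a (v * u)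

lemma dixmierSet_subset_of_mem {a x : A} (hx : x ∈ dixmierSet a) :
    dixmierSet x ⊆ dixmierSet a :=
  dixmierSet_subset (isClosed_dixmierSet a) (convex_dixmierSet a) (conj_mem_dixmierSet_of_mem hx)

lemma norm_conj (a : A) (u : unitary A) : ‖(u : A) * a * star (u : A)‖ = ‖a‖ := by
  rw [← Unitary.coe_star, CStarRing.norm_mul_coe_unitary, CStarRing.norm_coe_unitary_mul]

lemma norm_le_of_mem_dixmierSet {a x : A} (hx : x ∈ dixmierSet a) : ‖x‖ ≤ ‖a‖ := by
  have := dixmierSet_subset (S := Metric.closedBall (0 : A) ‖a‖) Metric.isClosed_closedBall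
    (convex_closedBall _ _) (fun u => by simp [norm_conj]) hx
  simpa using this

lemma conj_eq_of_mem_center {z : A} (hz : z ∈ Set.center A) (u : unitary A) :
    (u : A) * z * star (u : A) = z := by
  rw [← (Set.mem_center_iff.1 hz).comm, mul_assoc]; simp

lemma eq_of_mem_dixmierSet_of_mem_center {z x : A} (hz : z ∈ Set.center A)
    (hx : x ∈ dixmierSet z) : x = z := by
  simpa using dixmierSet_subset (S := {z}) isClosed_singleton (convex_singleton z)
    (fun u => by simp [conj_eq_of_mem_center hz]) hx

lemma center_mul_mem_dixmierSet {z a x : A} (hz : z ∈ Set.center A) (hx : x ∈ dixmierSet a) :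
    z * x ∈ dixmierSet (z * a) := by
  have := map_mem_dixmierSet (LinearMap.mulLeft ℝ z) (by
    change Continuous fun x => z * x
    fun_prop) (b := z * a) (fun u => ?_) hx
  · simpa using this
  · have h := conj_mem_dixmierSet (z * a) u
    have hzu : (u : A) * z = z * u := ((Set.mem_center_iff.1 hz).comm _).symm
    simpa [← mul_assoc, hzu] using h

lemma eq_of_mem_dixmierSet_of_trace {E : Type*} [NormedAddCommGroup E] [NormedSpace ℂ E]
    (f : A →L[ℂ] E) (hf : ∀ a b, f (a * b) = f (b * a)) {a x : A} (hx : x ∈ dixmierSet a) :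
    f x = f a := by
  refine dixmierSet_subset (S := f ⁻¹' {f a}) (isClosed_singleton.preimage f.continuous)
    ((convex_singleton (f a)).linear_preimage (f.toLinearMap.restrictScalars ℝ)) (fun u => ?_) hx
  simp only [Set.mem_preimage, Set.mem_singleton_iff]
  rw [hf, ← mul_assoc]; simp

lemma exists_eq_star_mul_self_of_mem_dixmierSet {a x : A} (hx : x ∈ dixmierSet (star a * a)) :
    ∃ b : A, x = star b * b := by
  let _ : PartialOrder A := CStarAlgebra.spectralOrder A
  have : StarOrderedRing A := CStarAlgebra.spectralOrderedRing A
  have : 0 ≤ x := dixmierSet_subset (S := {x : A | 0 ≤ x}) CStarAlgebra.isClosed_nonneg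
    (convex_Ici (𝕜 := ℝ) (0 : A))
    (fun u => star_right_conjugate_nonneg (star_mul_self_nonneg a) (u : A)) hx
  exact CStarAlgebra.nonneg_iff_eq_star_mul_self.1 this

/-- The convex hull of the inner automorphisms given by unitaries. -/
def averagingMaps (A : Type*) [CStarAlgebra A] : Set (A →ₗ[ℝ] A) :=
  convexHull ℝ (Set.range unitaryConj)

lemma exists_averagingMap {a x : A}
    (hx : x ∈ convexHull ℝ {b : A | ∃ u : unitary A, b = (u : A) * a * star (u : A)}) :
    ∃ α ∈ averagingMaps A, α a = x := by
  have h : {b : A | ∃ u : unitary A, b = (u : A) * a * star (u : A)} =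
      (LinearMap.applyₗ a : (A →ₗ[ℝ] A) →ₗ[ℝ] A) '' Set.range unitaryConj := by
    ext b
    simp [eq_comm]
  rw [h, ← LinearMap.image_convexHull] at hx
  simpa [averagingMaps] using hx

lemma averagingMap_mem_dixmierSet {α : A →ₗ[ℝ] A} (hα : α ∈ averagingMaps A) (a : A) :
    α a ∈ dixmierSet a := by
  have : averagingMaps A ⊆ (LinearMap.applyₗ a : (A →ₗ[ℝ] A) →ₗ[ℝ] A) ⁻¹' dixmierSet a := by
    refine convexHull_min ?_ ((convex_dixmierSet a).linear_preimage _)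
    rintro _ ⟨u, rfl⟩
    simpa using conj_mem_dixmierSet a u
  exact this hα

lemma exists_averagingMap_norm_sub_lt {a x : A} (hx : x ∈ dixmierSet a) {ε : ℝ} (hε : 0 < ε) :
    ∃ α ∈ averagingMaps A, ‖α a - x‖ < ε := by
  obtain ⟨y, hy, hxy⟩ := Metric.mem_closure_iff.1 hx ε hε
  obtain ⟨α, hα, rfl⟩ := exists_averagingMap hy
  exact ⟨α, hα, by rwa [← dist_eq_norm, dist_comm]⟩

lemma averagingMap_apply_center {α : A →ₗ[ℝ] A} (hα : α ∈ averagingMaps A) {z : A}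
    (hz : z ∈ Set.center A) : α z = z :=
  eq_of_mem_dixmierSet_of_mem_center hz (averagingMap_mem_dixmierSet hα z)

/-- If `x` is a central element of `D(a)` and `y` lies in `D(c)` for every `c` in `D(b)`, then
`x + y` lies in `D(a + b)`. -/
lemma add_mem_dixmierSet {a b x y : A} (hx : x ∈ dixmierSet a) (hxc : x ∈ Set.center A)
    (hy : ∀ c ∈ dixmierSet b, y ∈ dixmierSet c) : x + y ∈ dixmierSet (a + b) := by
  rw [← (isClosed_dixmierSet (a + b)).closure_eq, Metric.mem_closure_iff]
  intro ε hε
  obtain ⟨α, hα, hαx⟩ := exists_averagingMap_norm_sub_lt hx (half_pos hε)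
  obtain ⟨β, hβ, hβy⟩ := exists_averagingMap_norm_sub_lt
    (hy _ (averagingMap_mem_dixmierSet hα b)) (half_pos hε)
  refine ⟨β (α (a + b)), dixmierSet_subset_of_mem (averagingMap_mem_dixmierSet hα _)
    (averagingMap_mem_dixmierSet hβ _), ?_⟩
  have h1 : ‖β (α a) - x‖ < ε / 2 := by
    rw [← averagingMap_apply_center hβ hxc, ← map_sub]
    exact (norm_le_of_mem_dixmierSet (averagingMap_mem_dixmierSet hβ _)).trans_lt hαx
  rw [dist_comm, dist_eq_norm, map_add, map_add]
  calc ‖β (α a) + β (α b) - (x + y)‖ = ‖(β (α a) - x) + (β (α b) - y)‖ := by congr 1; abel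
    _ ≤ _ := norm_add_le _ _
    _ < ε := by linarith

end DixmierSet

section CentreValuedTrace

lemma IsCentreValuedTrace.dixmierSet_inter_center (hDP : DixmierProperty A) {R : A →L[ℂ] A}
    (hR : IsCentreValuedTrace R) (a : A) : dixmierSet a ∩ Set.center A = {R a} := by
  refine (Set.subset_singleton_iff_eq.1 ?_).resolve_left (hDP a).ne_empty
  rintro z ⟨hz, hzc⟩
  rw [Set.mem_singleton_iff, ← eq_of_mem_dixmierSet_of_trace R hR.2.2.2.2 hz, hR.2.2.2.1 z hzc]

lemma IsCentreValuedTrace.mem_dixmierSet (hDP : DixmierProperty A) {R : A →L[ℂ] A}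
    (hR : IsCentreValuedTrace R) (a : A) : R a ∈ dixmierSet a :=
  Set.inter_subset_left ((hR.dixmierSet_inter_center hDP a).ge rfl)

lemma IsCentreValuedTrace.map_center_mul (hDP : DixmierProperty A) {R : A →L[ℂ] A}
    (hR : IsCentreValuedTrace R) {z : A} (hz : z ∈ Set.center A) (a : A) :
    R (z * a) = z * R a := by
  have h : z * R a ∈ dixmierSet (z * a) ∩ Set.center A :=
    ⟨center_mul_mem_dixmierSet hz (hR.mem_dixmierSet hDP a), Set.mul_mem_center hz (hR.1 a)⟩
  rw [hR.dixmierSet_inter_center hDP] at h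
  exact h.symm

lemma SingletonDixmierProperty.exists_isCentreValuedTrace (h : SingletonDixmierProperty A) :
    ∃ R : A →L[ℂ] A, IsCentreValuedTrace R := by
  choose R hR using h
  have mem (a : A) : R a ∈ dixmierSet a ∩ Set.center A := (hR a).ge rfl
  have eq_of {a x : A} (hx : x ∈ dixmierSet a) (hxc : x ∈ Set.center A) : R a = x :=
    ((hR a).le ⟨hx, hxc⟩).symm
  have eq_of_mem {a c : A} (hc : c ∈ dixmierSet a) : R a = R c :=
    eq_of (dixmierSet_subset_of_mem hc (mem c).1) (mem c).2
  have hadd (a b : A) : R (a + b) = R a + R b := by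
    refine eq_of (add_mem_dixmierSet (mem a).1 (mem a).2 fun c hc => ?_)
      (Set.add_mem_center (mem a).2 (mem b).2)
    rw [eq_of_mem hc]
    exact (mem c).1
  have hsmul (c : ℂ) (a : A) : R (c • a) = c • R a := by
    have hc := Set.algebraMap_mem_center (A := A) c
    rw [Algebra.smul_def, Algebra.smul_def]
    exact eq_of (center_mul_mem_dixmierSet hc (mem a).1) (Set.mul_mem_center hc (mem a).2)
  let L : A →ₗ[ℂ] A := ⟨⟨R, hadd⟩, hsmul⟩
  refine ⟨L.mkContinuous 1 fun a => by simpa [L] using norm_le_of_mem_dixmierSet (mem a).1,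
    fun a => (mem a).2, L.mkContinuous_norm_le zero_le_one _,
    fun a => exists_eq_star_mul_self_of_mem_dixmierSet (mem _).1,
    fun z hz => eq_of_mem_dixmierSet_of_mem_center hz (mem z).1, fun a b => ?_⟩
  change L (a * b) = L (b * a)
  have ha : a ∈ Submodule.span ℂ (unitary A : Set A) := by
    rw [CStarAlgebra.span_unitary]; trivial
  induction ha using Submodule.span_induction with
  | mem u hu =>
    have := conj_mem_dixmierSet (b * u) ⟨u, hu⟩
    refine (eq_of_mem (a := b * u) (c := u * b) ?_).symm
    simpa [mul_assoc, Unitary.mul_star_self_of_mem hu] using this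
  | zero => simp
  | add x y _ _ hx hy => simp [add_mul, mul_add, hx, hy]
  | smul c x _ hx => simp [hx]

end CentreValuedTrace

section Centre

/-- The centre of a C*-algebra as a star subalgebra. -/
def centreStarSubalgebra (A : Type*) [CStarAlgebra A] : StarSubalgebra ℂ A :=
  { Subalgebra.center ℂ A with
    star_mem' := fun h => Set.star_mem_center h }

lemma mem_centreStarSubalgebra {z : A} : z ∈ centreStarSubalgebra A ↔ z ∈ Set.center A := Iff.rfl

lemma commute_of_centre (z : centreStarSubalgebra A) (a : A) : (z : A) * a = a * z :=
  (Set.mem_center_iff.1 z.2).comm a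

instance isClosed_centreStarSubalgebra :
    IsClosed (centreStarSubalgebra A : Set A) := by
  have : (centreStarSubalgebra A : Set A) = ⋂ a : A, {z | a * z = z * a} := by
    ext z
    simp only [SetLike.mem_coe, mem_centreStarSubalgebra, Semigroup.mem_center_iff,
      Set.mem_iInter, Set.mem_ofPred_eq]
  rw [this]
  exact isClosed_iInter fun a => isClosed_eq (by fun_prop) (by fun_prop)

instance : CommCStarAlgebra (centreStarSubalgebra A) where
  mul_comm x y := Subtype.ext (commute_of_centre x y)

open WeakDual

lemma norm_character_apply_le (φ : characterSpace ℂ (centreStarSubalgebra A))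
    (z : centreStarSubalgebra A) : ‖φ z‖ ≤ ‖z‖ := by
  have : Nontrivial (centreStarSubalgebra A) :=
    ⟨1, 0, fun h => by simpa using congrArg φ h⟩
  exact spectrum.norm_le_norm_of_mem (AlgHom.apply_mem_spectrum φ z)

/-- A central element on which a character vanishes is almost annihilated by a central
contraction on which the character is one. -/
lemma exists_centre_norm_mul_le (φ : characterSpace ℂ (centreStarSubalgebra A))
    {z : centreStarSubalgebra A} (hz : φ z = 0) {ε : ℝ} (hε : 0 < ε) :
    ∃ e : centreStarSubalgebra A, φ e = 1 ∧ ‖e‖ ≤ 1 ∧ ‖e * z‖ ≤ ε := by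
  let Φ := gelfandStarTransform (centreStarSubalgebra A)
  have hΦ (x : centreStarSubalgebra A) : ‖Φ x‖ = ‖x‖ :=
    (gelfandTransform_isometry (centreStarSubalgebra A)).norm_map_of_map_zero (map_zero _) x
  let g := Φ z
  let f : C(characterSpace ℂ (centreStarSubalgebra A), ℂ) :=
    ⟨fun ψ => ((max 0 (1 - ‖g ψ‖ / ε) : ℝ) : ℂ), by fun_prop⟩
  have hf (ψ) : ‖f ψ‖ = max 0 (1 - ‖g ψ‖ / ε) := by
    simp only [f, ContinuousMap.coe_mk, Complex.norm_real, Real.norm_eq_abs]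
    exact abs_of_nonneg (le_max_left _ _)
  refine ⟨Φ.symm f, ?_, ?_, ?_⟩
  · have h1 : φ (Φ.symm f) = Φ (Φ.symm f) φ := rfl
    have h2 : g φ = 0 := hz
    rw [h1, StarAlgEquiv.apply_symm_apply]
    simp [f, h2]
  · rw [← hΦ, StarAlgEquiv.apply_symm_apply, ContinuousMap.norm_le _ zero_le_one]
    intro ψ
    rw [hf]
    have : 0 ≤ ‖g ψ‖ / ε := by positivity
    exact max_le zero_le_one (by linarith)
  · rw [← hΦ, map_mul, StarAlgEquiv.apply_symm_apply, ContinuousMap.norm_le _ hε.le]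
    intro ψ
    change ‖f ψ * g ψ‖ ≤ ε
    rw [norm_mul, hf]
    by_cases h : ‖g ψ‖ ≤ ε
    · have : 0 ≤ ‖g ψ‖ / ε := by positivity
      calc _ ≤ 1 * ‖g ψ‖ := by gcongr; exact max_le zero_le_one (by linarith)
        _ ≤ ε := by linarith
    · have : 1 ≤ ‖g ψ‖ / ε := by rw [le_div_iff₀ hε]; linarith
      rw [max_eq_left (by linarith)]
      simpa using hε.le

/-- The ideal of elements almost annihilated by central contractions on which `φ` is one. -/
def characterIdeal (φ : characterSpace ℂ (centreStarSubalgebra A)) : Submodule ℂ A where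
  carrier := {a | ∀ ε : ℝ, 0 < ε →
    ∃ e : centreStarSubalgebra A, φ e = 1 ∧ ‖e‖ ≤ 1 ∧ ‖(e : A) * a‖ ≤ ε}
  zero_mem' ε hε := by
    obtain ⟨e, h1, h2, -⟩ := exists_centre_norm_mul_le φ (map_zero φ) hε
    exact ⟨e, h1, h2, by simpa using hε.le⟩
  add_mem' {a b} ha hb ε hε := by
    obtain ⟨e, he, hen, hea⟩ := ha (ε / 2) (half_pos hε)
    obtain ⟨f, hf, hfn, hfb⟩ := hb (ε / 2) (half_pos hε)
    refine ⟨f * e, by simp [he, hf], (norm_mul_le _ _).trans (mul_le_one₀ hfn (norm_nonneg _) hen),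
      ?_⟩
    have h1 : ‖(f : A) * ((e : A) * a)‖ ≤ ε / 2 :=
      calc _ ≤ ‖(f : A)‖ * ‖(e : A) * a‖ := norm_mul_le _ _
        _ ≤ 1 * ‖(e : A) * a‖ := by gcongr; exact hfn
        _ ≤ ε / 2 := by linarith
    have h2 : ‖(e : A) * ((f : A) * b)‖ ≤ ε / 2 :=
      calc _ ≤ ‖(e : A)‖ * ‖(f : A) * b‖ := norm_mul_le _ _
        _ ≤ 1 * ‖(f : A) * b‖ := by gcongr; exact hen
        _ ≤ ε / 2 := by linarith
    have h3 : ((f * e : centreStarSubalgebra A) : A) * (a + b) =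
        (f : A) * ((e : A) * a) + (e : A) * ((f : A) * b) := by
      rw [MulMemClass.coe_mul, mul_add, mul_assoc, commute_of_centre f e, mul_assoc]
    rw [h3]
    exact (norm_add_le _ _).trans (by linarith)
  smul_mem' c a ha ε hε := by
    obtain ⟨e, he, hen, hea⟩ := ha (ε / (‖c‖ + 1)) (by positivity)
    refine ⟨e, he, hen, ?_⟩
    rw [mul_smul_comm, norm_smul]
    calc ‖c‖ * ‖(e : A) * a‖ ≤ (‖c‖ + 1) * (ε / (‖c‖ + 1)) := by gcongr; linarith
      _ = ε := by field_simp

lemma mul_mem_characterIdeal (φ : characterSpace ℂ (centreStarSubalgebra A)) (a b : A)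
    (hb : b ∈ characterIdeal φ) : a * b ∈ characterIdeal φ ∧ b * a ∈ characterIdeal φ := by
  refine ⟨fun ε hε => ?_, fun ε hε => ?_⟩ <;>
  obtain ⟨e, he, hen, heb⟩ := hb (ε / (‖a‖ + 1)) (by positivity) <;>
  refine ⟨e, he, hen, ?_⟩
  · rw [← mul_assoc, commute_of_centre, mul_assoc]
    calc _ ≤ ‖a‖ * ‖(e : A) * b‖ := norm_mul_le _ _
      _ ≤ (‖a‖ + 1) * (ε / (‖a‖ + 1)) := by gcongr; linarith
      _ = ε := by field_simp
  · rw [← mul_assoc]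
    calc _ ≤ ‖(e : A) * b‖ * ‖a‖ := norm_mul_le _ _
      _ ≤ (ε / (‖a‖ + 1)) * (‖a‖ + 1) := by gcongr; linarith
      _ = ε := by field_simp

lemma one_notMem_characterIdeal (φ : characterSpace ℂ (centreStarSubalgebra A)) :
    (1 : A) ∉ characterIdeal φ := by
  intro h
  obtain ⟨e, he, -, hle⟩ := h (1 / 2) (by norm_num)
  have h1 := norm_character_apply_le φ e
  rw [he, norm_one] at h1
  rw [mul_one] at hle
  have : (1 : ℝ) ≤ 1 / 2 := h1.trans hle
  norm_num at this

lemma mem_characterIdeal (φ : characterSpace ℂ (centreStarSubalgebra A))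
    {z : centreStarSubalgebra A} (hz : φ z = 0) : (z : A) ∈ characterIdeal φ :=
  fun _ hε => exists_centre_norm_mul_le φ hz hε

end Centre

section MaximalIdeal

lemma one_notMem_of_ne_top {I : Submodule ℂ A} (hI : ∀ a b : A, b ∈ I → a * b ∈ I ∧ b * a ∈ I)
    (h : I ≠ ⊤) : (1 : A) ∉ I := fun h1 =>
  h (eq_top_iff.2 fun a _ => by simpa using (hI a 1 h1).1)

lemma isClosedTwoSidedIdeal_topologicalClosure {I : Submodule ℂ A}
    (hI : ∀ a b : A, b ∈ I → a * b ∈ I ∧ b * a ∈ I) :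
    IsClosedTwoSidedIdeal I.topologicalClosure :=
  ⟨I.isClosed_topologicalClosure, fun a _ hb =>
    ⟨map_mem_closure (f := fun x => a * x) (by fun_prop) hb fun x hx => (hI a x hx).1,
      map_mem_closure (f := fun x => x * a) (by fun_prop) hb fun x hx => (hI a x hx).2⟩⟩

lemma one_notMem_topologicalClosure {I : Submodule ℂ A}
    (hI : ∀ a b : A, b ∈ I → a * b ∈ I ∧ b * a ∈ I) (h1 : (1 : A) ∉ I) :
    (1 : A) ∉ I.topologicalClosure := by
  intro h
  obtain ⟨x, hx, hd⟩ := Metric.mem_closure_iff.1 h 1 one_pos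
  rw [dist_eq_norm] at hd
  have hu := isUnit_one_sub_of_norm_lt_one hd
  rw [sub_sub_cancel] at hu
  obtain ⟨u, rfl⟩ := hu
  exact h1 (by simpa using (hI (↑u⁻¹) _ hx).1)

lemma IsMaximalClosedIdeal.le_of_le {M I : Submodule ℂ A} (hM : IsMaximalClosedIdeal M)
    (hI : ∀ a b : A, b ∈ I → a * b ∈ I ∧ b * a ∈ I) (h1 : (1 : A) ∉ I) (h : M ≤ I) : I ≤ M := by
  rw [← hM.2.2 _ (isClosedTwoSidedIdeal_topologicalClosure hI)
    (fun ht => one_notMem_topologicalClosure hI h1 (ht ▸ Submodule.mem_top))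
    (h.trans I.le_topologicalClosure)]
  exact I.le_topologicalClosure

lemma exists_isMaximalClosedIdeal_ge {I : Submodule ℂ A}
    (hI : ∀ a b : A, b ∈ I → a * b ∈ I ∧ b * a ∈ I) (h1 : (1 : A) ∉ I) :
    ∃ M : Submodule ℂ A, IsMaximalClosedIdeal M ∧ I ≤ M := by
  obtain ⟨M, hIM, hM⟩ := zorn_le_nonempty₀
    {J : Submodule ℂ A | (∀ a b : A, b ∈ J → a * b ∈ J ∧ b * a ∈ J) ∧ (1 : A) ∉ J}
    (fun c hc hchain J hJ => by
      have mem {x : A} : x ∈ sSup c ↔ ∃ K ∈ c, x ∈ K :=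
        Submodule.mem_sSup_of_directed ⟨J, hJ⟩ hchain.directedOn
      refine ⟨sSup c, ⟨fun a b hb => ?_, fun h => ?_⟩, fun K hK => le_sSup hK⟩
      · obtain ⟨K, hK, hbK⟩ := mem.1 hb
        exact ⟨mem.2 ⟨K, hK, ((hc hK).1 a b hbK).1⟩, mem.2 ⟨K, hK, ((hc hK).1 a b hbK).2⟩⟩
      · obtain ⟨K, hK, h1K⟩ := mem.1 h
        exact (hc hK).2 h1K) I ⟨hI, h1⟩
  have hcl := isClosedTwoSidedIdeal_topologicalClosure hM.prop.1
  have heq : M.topologicalClosure = M :=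
    le_antisymm (hM.le_of_ge ⟨hcl.2, one_notMem_topologicalClosure hM.prop.1 hM.prop.2⟩
      M.le_topologicalClosure) M.le_topologicalClosure
  rw [heq] at hcl
  refine ⟨M, ⟨hcl, fun h => hM.prop.2 (h ▸ Submodule.mem_top), fun J hJ hJt hMJ => ?_⟩, hIM⟩
  exact le_antisymm (hM.le_of_ge ⟨hJ.2, one_notMem_of_ne_top hJ.2 hJt⟩ hMJ) hMJ

end MaximalIdeal

section TracialState

open WeakDual

lemma character_nonneg (φ : characterSpace ℂ (centreStarSubalgebra A))
    {z : centreStarSubalgebra A} {b : A} (hz : (z : A) = star b * b) : 0 ≤ φ z := by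
  let _ : PartialOrder A := CStarAlgebra.spectralOrder A
  have : StarOrderedRing A := CStarAlgebra.spectralOrderedRing A
  have h : φ z ∈ spectrum ℂ (z : A) := by
    rw [← StarSubalgebra.spectrum_eq (hS := isClosed_centreStarSubalgebra)]
    exact AlgHom.apply_mem_spectrum φ z
  rw [hz] at h
  exact spectrum_nonneg_of_nonneg (star_mul_self_nonneg b) h

/-- The composition of a centre-valued trace with a character of the centre. -/
lemma IsCentreValuedTrace.exists_isTracialState {R : A →L[ℂ] A} (hR : IsCentreValuedTrace R)
    (φ : characterSpace ℂ (centreStarSubalgebra A)) :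
    ∃ τ : A →L[ℂ] ℂ, IsTracialState τ ∧ ∀ a, τ a = φ ⟨R a, hR.1 a⟩ := by
  let L : A →ₗ[ℂ] ℂ :=
    { toFun := fun a => φ ⟨R a, hR.1 a⟩
      map_add' := fun a b => by
        rw [← map_add]; congr 1; exact Subtype.ext (map_add R a b)
      map_smul' := fun c a => by
        rw [RingHom.id_apply, ← map_smul]; congr 1; exact Subtype.ext (map_smul R c a) }
  have hL (a : A) : ‖L a‖ ≤ 1 * ‖a‖ :=
    (norm_character_apply_le φ _).trans (R.le_of_opNorm_le hR.2.1 a)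
  refine ⟨L.mkContinuous 1 hL, ⟨le_antisymm (L.mkContinuous_norm_le zero_le_one _) ?_,
    fun a => ?_, fun a b => ?_⟩, fun a => rfl⟩
  · have h1 : L.mkContinuous 1 hL 1 = 1 := by
      change φ ⟨R 1, hR.1 1⟩ = 1
      rw [← map_one φ]; congr 1
      exact Subtype.ext (hR.2.2.2.1 1 Set.one_mem_center)
    have : Nontrivial A := ⟨1, 0, fun h => by simp [h] at h1⟩
    simpa [h1] using (L.mkContinuous 1 hL).le_opNorm 1
  · obtain ⟨b, hb⟩ := hR.2.2.1 a
    exact character_nonneg φ hb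
  · change φ _ = φ _
    congr 1
    exact Subtype.ext (hR.2.2.2.2 a b)

/-- The largest two-sided ideal on which a trace vanishes. -/
def traceIdeal (τ : A →L[ℂ] ℂ) : Submodule ℂ A where
  carrier := {a | ∀ x, τ (x * a) = 0}
  zero_mem' := by simp
  add_mem' ha hb x := by rw [mul_add, map_add, ha, hb, add_zero]
  smul_mem' c a ha x := by rw [mul_smul_comm, map_smul, ha, smul_zero]

lemma mul_mem_traceIdeal {τ : A →L[ℂ] ℂ} (hτ : ∀ a b, τ (a * b) = τ (b * a)) (a b : A)
    (hb : b ∈ traceIdeal τ) : a * b ∈ traceIdeal τ ∧ b * a ∈ traceIdeal τ :=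
  ⟨fun x => by rw [← mul_assoc]; exact hb _,
    fun x => by rw [← mul_assoc, hτ, ← mul_assoc]; exact hb _⟩

/-- The intersection of a maximal ideal with the centre lies in the kernel of some character. -/
lemma IsMaximalClosedIdeal.exists_character {M : Submodule ℂ A} (hM : IsMaximalClosedIdeal M) :
    ∃ φ : characterSpace ℂ (centreStarSubalgebra A),
      ∀ z : centreStarSubalgebra A, (z : A) ∈ M → φ z = 0 := by
  let N : Ideal (centreStarSubalgebra A) :=
    { carrier := {z | (z : A) ∈ M}
      zero_mem' := M.zero_mem
      add_mem' := M.add_mem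
      smul_mem' := fun c z hz => (hM.1.2 c z hz).1 }
  have hN : N ≠ ⊤ := fun h =>
    one_notMem_of_ne_top hM.1.2 hM.2.1 ((Ideal.eq_top_iff_one N).1 h)
  obtain ⟨K, hK, hNK⟩ := N.exists_le_maximal hN
  exact ⟨K.toCharacterSpace, fun z hz => K.toCharacterSpace_apply_eq_zero_of_mem (hNK hz)⟩

lemma IsCentreValuedTrace.existsUnique_isTracialState (hDP : DixmierProperty A) {R : A →L[ℂ] A}
    (hR : IsCentreValuedTrace R) {M : Submodule ℂ A} (hM : IsMaximalClosedIdeal M) :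
    ∃! τ : A →L[ℂ] ℂ, IsTracialState τ ∧ ∀ x ∈ M, τ x = 0 := by
  obtain ⟨φ, hφ⟩ := hM.exists_character
  obtain ⟨τ, hτ, hτφ⟩ := hR.exists_isTracialState φ
  have hτM : ∀ x ∈ M, τ x = 0 := fun x hx => by
    rw [hτφ]
    refine hφ _ (dixmierSet_subset hM.1.1 ?_ (fun u => ?_) (hR.mem_dixmierSet hDP x))
    · exact (M.restrictScalars ℝ).convex
    · exact (hM.1.2 _ _ (hM.1.2 _ _ hx).1).2
  have hτ1 : τ 1 = 1 := by
    rw [hτφ, ← map_one φ]; congr 1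
    exact Subtype.ext (hR.2.2.2.1 1 Set.one_mem_center)
  have hker : ∀ z : centreStarSubalgebra A, φ z = 0 → (z : A) ∈ M := fun z hz => by
    refine hM.le_of_le (mul_mem_traceIdeal hτ.2.2) (fun h => ?_)
      (fun x hx y => hτM _ (hM.1.2 y x hx).1) (fun x => ?_)
    · simpa [hτ1] using h 1
    · rw [← commute_of_centre, hτφ]
      have : (⟨R (z * x), hR.1 _⟩ : centreStarSubalgebra A) = z * ⟨R x, hR.1 x⟩ :=
        Subtype.ext (hR.map_center_mul hDP z.2 x)
      rw [this, map_mul, hz, zero_mul]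
  refine ⟨τ, ⟨hτ, hτM⟩, fun σ ⟨hσ, hσM⟩ => ?_⟩
  have hσ' : σ = σ 1 • τ := by
    ext a
    rw [← eq_of_mem_dixmierSet_of_trace σ hσ.2.2 (hR.mem_dixmierSet hDP a)]
    have h := hker (⟨R a, hR.1 a⟩ - algebraMap ℂ _ (τ a)) (by
      rw [map_sub, ← hτφ, AlgHomClass.commutes, Algebra.algebraMap_self_apply, sub_self])
    have h2 := hσM _ h
    have h3 : (((⟨R a, hR.1 a⟩ - algebraMap ℂ _ (τ a) : centreStarSubalgebra A)) : A) =
        R a - τ a • (1 : A) := by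
      rw [← Algebra.algebraMap_eq_smul_one]; rfl
    rw [h3, map_sub, map_smul, sub_eq_zero] at h2
    rw [h2, smul_eq_mul, smul_apply, smul_eq_mul, mul_comm]
  have hn : ‖σ 1‖ = 1 := by
    have := hσ.1
    rwa [hσ', norm_smul, hτ.1, mul_one] at this
  have h0 : 0 ≤ σ 1 := by simpa using hσ.2.1 1
  have h1 : σ 1 = 1 := by
    rw [← RCLike.norm_of_nonneg' h0, hn]; simp
  rw [hσ', h1, one_smul]

lemma singletonDixmierProperty_of_tracialStates (hDP : DixmierProperty A)
    (h : ∀ M : Submodule ℂ A, IsMaximalClosedIdeal M →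
      ∃ τ : A →L[ℂ] ℂ, IsTracialState τ ∧ ∀ x ∈ M, τ x = 0) :
    SingletonDixmierProperty A := by
  intro a
  obtain ⟨z, hz⟩ := hDP a
  refine ⟨z, Set.eq_singleton_iff_unique_mem.2 ⟨hz, fun w hw => ?_⟩⟩
  have key : (⟨w, hw.2⟩ : centreStarSubalgebra A) = ⟨z, hz.2⟩ := by
    refine (gelfandTransform_bijective _).1 (DFunLike.ext _ _ fun φ => ?_)
    change φ _ = φ _
    obtain ⟨M, hM, hφM⟩ := exists_isMaximalClosedIdeal_ge (mul_mem_characterIdeal φ)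
      (one_notMem_characterIdeal φ)
    obtain ⟨τ, hτ, hτM⟩ := h M hM
    have hτφ (x : centreStarSubalgebra A) : τ x = φ x * τ 1 := by
      have h2 := hτM _ (hφM (mem_characterIdeal φ (z := x - algebraMap ℂ _ (φ x)) (by
        rw [map_sub, AlgHomClass.commutes, Algebra.algebraMap_self_apply, sub_self])))
      have h3 : ((x - algebraMap ℂ _ (φ x) : centreStarSubalgebra A) : A) =
          x - φ x • (1 : A) := by
        rw [← Algebra.algebraMap_eq_smul_one]; rfl
      rwa [h3, map_sub, map_smul, sub_eq_zero] at h2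
    have hτ1 : τ 1 ≠ 0 := fun h0 => by
      have : τ = 0 := by
        ext b
        obtain ⟨x, hx, hxc⟩ := hDP b
        rw [← eq_of_mem_dixmierSet_of_trace τ hτ.2.2 hx, hτφ ⟨x, hxc⟩, h0, mul_zero]
        rfl
      simpa [this] using hτ.1
    refine mul_right_cancel₀ hτ1 ?_
    rw [← hτφ, ← hτφ]
    exact (eq_of_mem_dixmierSet_of_trace τ hτ.2.2 hw.1).trans
      (eq_of_mem_dixmierSet_of_trace τ hτ.2.2 hz.1).symm
  exact congrArg Subtype.val key

end TracialState

/-- **Proposition 1.4.**  For a unital C*-algebra with the Dixmier property, the singleton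
Dixmier property is equivalent to the existence of a centre-valued trace, and also to
`T(A/M)` being non-empty for every maximal ideal `M` (tracial states of `A/M` are identified
with tracial states of `A` vanishing on `M`).  Moreover, in that case the centre-valued trace
`R` is unique, `{R a} = D_A(a) ∩ Z(A)` for all `a`, and `T(A/M)` is a singleton for every
maximal ideal `M`. -/
theorem singletonDixmier_iff_centreValuedTrace (A : Type*) [CStarAlgebra A]
    (hDP : DixmierProperty A) :
    ((SingletonDixmierProperty A ↔ ∃ R : A →L[ℂ] A, IsCentreValuedTrace R) ∧
     (SingletonDixmierProperty A ↔ ∀ M : Submodule ℂ A, IsMaximalClosedIdeal M →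
        ∃ τ : A →L[ℂ] ℂ, IsTracialState τ ∧ ∀ x ∈ M, τ x = 0)) ∧
    (SingletonDixmierProperty A →
      ((∃! R : A →L[ℂ] A, IsCentreValuedTrace R) ∧
       (∀ R : A →L[ℂ] A, IsCentreValuedTrace R →
          ∀ a : A, dixmierSet a ∩ Set.center A = {R a}) ∧
       (∀ M : Submodule ℂ A, IsMaximalClosedIdeal M →
          ∃! τ : A →L[ℂ] ℂ, IsTracialState τ ∧ ∀ x ∈ M, τ x = 0))) := by
  have hSR : SingletonDixmierProperty A ↔ ∃ R : A →L[ℂ] A, IsCentreValuedTrace R :=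
    ⟨fun h => h.exists_isCentreValuedTrace,
      fun ⟨R, hR⟩ a => ⟨R a, hR.dixmierSet_inter_center hDP a⟩⟩
  refine ⟨⟨hSR, fun h M hM => ?_, singletonDixmierProperty_of_tracialStates hDP⟩, fun h => ?_⟩
  · obtain ⟨R, hR⟩ := hSR.1 h
    exact (hR.existsUnique_isTracialState hDP hM).exists
  · obtain ⟨R, hR⟩ := hSR.1 h
    refine ⟨⟨R, hR, fun S hS => ?_⟩, fun S hS => hS.dixmierSet_inter_center hDP,
      fun M hM => hR.existsUnique_isTracialState hDP hM⟩
    ext a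
    exact Set.singleton_injective
      ((hS.dixmierSet_inter_center hDP a).symm.trans (hR.dixmierSet_inter_center hDP a))

end
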